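/- arXiv:2202.12061 — 2 statements merged into one kernel-verified Lean document; each statement's English description precedes it below -/
import Mathlib

section
/- The Coxeter group of type H₃, i.e. the group associated with the Coxeter matrix [[1,5,2],[5,1,3],[2,3,1]], has exactly 120 elements. -/
/-- The Coxeter matrix of type H₃ (with the 5-bond between the first two generators). -/
def H3Matrix : CoxeterMatrix (Fin 3) where
  M := !![1, 5, 2;
          5, 1, 3;
          2, 3, 1]
  off_diagonal := by
    intro i j h
    fin_cases i <;> fin_cases j <;> simp at h ⊢

namespace H3

open Equiv CoxeterSystem

/-- The canonical Coxeter system of type `H₃`. -/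
def cs : CoxeterSystem H3Matrix H3Matrix.Group := H3Matrix.toCoxeterSystem

/-- Reduced words for the twelve minimal left coset representatives of the dihedral parabolic
subgroup generated by the simple reflections `0` and `1`. -/
def cosetWord : Fin 12 → List (Fin 3) :=
  ![[], [2], [1, 2], [0, 1, 2], [1, 0, 1, 2], [0, 1, 0, 1, 2], [2, 1, 0, 1, 2],
    [0, 2, 1, 0, 1, 2], [1, 0, 2, 1, 0, 1, 2], [0, 1, 0, 2, 1, 0, 1, 2],
    [1, 0, 1, 0, 2, 1, 0, 1, 2], [2, 1, 0, 1, 0, 2, 1, 0, 1, 2]]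

/-- Words for the ten elements of the dihedral parabolic subgroup: the alternating words
ending in `0`. -/
def dihedralWord (k : Fin 10) : List (Fin 3) := alternatingWord 1 0 k

/-- The permutations of the twelve cosets induced by the simple reflections. -/
def cosetPerm : Fin 3 → Perm (Fin 12) :=
  ![swap 2 3 * swap 4 5 * swap 6 7 * swap 8 9,
    swap 1 2 * swap 3 4 * swap 7 8 * swap 9 10,
    swap 0 1 * swap 4 6 * swap 5 7 * swap 10 11]

/-- The correction by an element of the parabolic subgroup that appears when a simple reflection
is moved past a coset representative. -/
def twist : Fin 3 → Fin 12 → List (Fin 3) :=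
  ![![[0], [0], [], [], [], [], [], [], [], [], [1], [1]],
    ![[1], [], [], [], [], [0], [1], [], [], [], [], [0]],
    ![[], [], [1], [1], [], [], [], [], [0], [0], [], []]]

section Rewriting

local notation "a" => cs.simple 0
local notation "b" => cs.simple 1
local notation "c" => cs.simple 2

theorem ca : c * a = a * c := by
  have h := cs.simple_mul_simple_pow 2 0
  rw [show H3Matrix 2 0 = 2 from rfl, pow_two, mul_eq_one_iff_eq_inv] at h
  simpa using h

theorem cbc : c * (b * c) = b * (c * b) := by
  have h := cs.simple_mul_simple_pow 2 1
  rw [show H3Matrix 2 1 = 3 from rfl,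
    show (c * b) ^ 3 = (c * (b * c)) * (b * (c * b)) by
      simp only [pow_succ, pow_zero, one_mul, mul_assoc],
    mul_eq_one_iff_eq_inv] at h
  simpa [mul_assoc] using h

theorem babab : b * (a * (b * (a * b))) = a * (b * (a * (b * a))) := by
  have h := cs.simple_mul_simple_pow 1 0
  rw [show H3Matrix 1 0 = 5 from rfl,
    show (b * a) ^ 5 = (b * (a * (b * (a * b)))) * (a * (b * (a * (b * a)))) by
      simp only [pow_succ, pow_zero, one_mul, mul_assoc],
    mul_eq_one_iff_eq_inv] at h
  simpa [mul_assoc] using h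

theorem cbac : c * (b * (a * c)) = b * (c * (b * a)) := by
  rw [← ca]; simpa only [mul_assoc] using congrArg (· * a) cbc

theorem cbabcb : c * (b * (a * (b * (c * b)))) = b * (c * (b * (a * (b * c)))) := by
  rw [← cbc]; simpa only [mul_assoc] using congrArg (· * (b * c)) cbac

theorem cbabacbaba : c * (b * (a * (b * (a * (c * (b * (a * (b * a)))))))) =
    b * (c * (b * (a * (b * (a * (c * (b * (a * b)))))))) := by
  have h₁ : b * (a * (b * a)) = a * (b * (a * (b * (a * b)))) := by
    simpa [mul_assoc] using congrArg (· * b) babab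
  have h₂ := congrArg (· * (a * (b * (a * b)))) cbabcb
  have h₃ : c * (a * (b * (a * b))) = a * (c * (b * (a * b))) := by
    simpa only [mul_assoc] using congrArg (· * (b * (a * b))) ca
  have h₄ : a * (c * (a * (b * (a * (b * (a * b)))))) = c * (b * (a * (b * (a * b)))) := by
    rw [← mul_assoc c a, ca]; simp [mul_assoc]
  rw [h₁, h₄]
  simpa only [mul_assoc, h₃] using h₂

variable (x : H3Matrix.Group)

theorem ca_mul : c * (a * x) = a * (c * x) := by
  simpa only [mul_assoc] using congrArg (· * x) ca

theorem babab_mul : b * (a * (b * (a * (b * x)))) = a * (b * (a * (b * (a * x)))) := by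
  simpa only [mul_assoc] using congrArg (· * x) babab

theorem cbac_mul : c * (b * (a * (c * x))) = b * (c * (b * (a * x))) := by
  simpa only [mul_assoc] using congrArg (· * x) cbac

theorem cbabacbaba_mul :
    c * (b * (a * (b * (a * (c * (b * (a * (b * (a * x))))))))) =
      b * (c * (b * (a * (b * (a * (c * (b * (a * (b * x))))))))) := by
  simpa only [mul_assoc] using congrArg (· * x) cbabacbaba

end Rewriting

theorem simple_mul_cosetWord (j : Fin 3) (i : Fin 12) :
    cs.simple j * cs.wordProd (cosetWord i) =
      cs.wordProd (cosetWord (cosetPerm j i)) * cs.wordProd (twist j i) := by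
  fin_cases j <;> fin_cases i <;>
    simp [cosetPerm, cosetWord, twist, wordProd_cons, mul_assoc, swap_apply_def,
      ca, cbc, cbabcb, ca_mul, babab_mul, cbac_mul, cbabacbaba_mul]

theorem simple_mul_dihedralWord {j : Fin 3} (hj : j ≠ 2) (k : Fin 10) :
    cs.simple j * cs.wordProd (dihedralWord k) =
      cs.wordProd (dihedralWord (if (j + k : ℕ) % 2 = 0 then k + 1 else k - 1)) := by
  fin_cases j <;> first | exact absurd rfl hj | skip
  all_goals fin_cases k <;>
    simp [dihedralWord, alternatingWord_succ', wordProd_cons, babab_mul, Nat.even_iff]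

/-- The product of a coset representative and an element of the dihedral subgroup. -/
def normalForm (p : Fin 12 × Fin 10) : H3Matrix.Group :=
  cs.wordProd (cosetWord p.1) * cs.wordProd (dihedralWord p.2)

theorem normalForm_surjective : Function.Surjective normalForm := by
  intro w
  induction w using cs.simple_induction_left with
  | one => exact ⟨(0, 0), by simp [normalForm, cosetWord, dihedralWord, alternatingWord]⟩
  | mul_simple_left w j ih =>
    obtain ⟨⟨i, k⟩, rfl⟩ := ih
    have key : twist j i = [] ∨ ∃ t, t ≠ 2 ∧ twist j i = [t] := by decide +revert
    rw [normalForm, ← mul_assoc, simple_mul_cosetWord, mul_assoc]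
    obtain h | ⟨t, ht, h⟩ := key
    · exact ⟨(cosetPerm j i, k), by simp [h, normalForm]⟩
    · rw [h, wordProd_singleton, simple_mul_dihedralWord ht]
      exact ⟨(_, _), rfl⟩

theorem cosetPerm_isLiftable : H3Matrix.IsLiftable cosetPerm := by
  unfold CoxeterMatrix.IsLiftable
  decide +kernel

/-- The action of the Coxeter group on the twelve cosets. -/
def permHom : H3Matrix.Group →* Perm (Fin 12) := cs.lift ⟨cosetPerm, cosetPerm_isLiftable⟩

theorem permHom_wordProd (l : List (Fin 3)) :
    permHom (cs.wordProd l) = (l.map cosetPerm).prod := by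
  induction l with
  | nil => simp
  | cons j l ih =>
    rw [wordProd_cons, map_mul, ih, permHom, lift_apply_simple]
    simp

theorem normalForm_injective : Function.Injective normalForm := by
  have hX : ∀ i, ((cosetWord i).map cosetPerm).prod 0 = i := by decide +kernel
  have hY : ∀ k, ((dihedralWord k).map cosetPerm).prod 0 = 0 := by decide +kernel
  have hY_inj : ∀ k k', ((dihedralWord k).map cosetPerm).prod 1 =
      ((dihedralWord k').map cosetPerm).prod 1 →
      ((dihedralWord k).map cosetPerm).prod 2 = ((dihedralWord k').map cosetPerm).prod 2 →
      k = k' := by decide +kernel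
  rintro ⟨i, k⟩ ⟨i', k'⟩ h
  have h_zero (i k) : permHom (normalForm (i, k)) 0 = i := by
    rw [normalForm, map_mul, permHom_wordProd, permHom_wordProd, Perm.mul_apply, hY, hX]
  obtain rfl : i = i' := by rw [← h_zero i k, h, h_zero]
  have hk := congrArg permHom (mul_left_cancel h)
  simp only [permHom_wordProd] at hk
  rw [hY_inj k k' (by rw [hk]) (by rw [hk])]

end H3

/-- The Coxeter group of type H₃ has exactly 120 elements. -/
theorem H3_card : Nat.card H3Matrix.Group = 120 := by
  rw [← Nat.card_congr (Equiv.ofBijective H3.normalForm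
    ⟨H3.normalForm_injective, H3.normalForm_surjective⟩)]
  simp
end

section
/- In the Coxeter group of type F₄ (Coxeter matrix [[1,3,2,2],[3,1,4,2],[2,4,1,3],[2,2,3,1]]), the longest element w₀ = π(4 3 4 2 3 4 2 3 2 1 2 3 4 2 3 1 2 3 4 1 2 3 2 1) (which has length 24) has exactly 2144892 reduced words, i.e. there are exactly 2144892 lists ω of generator indices with π(ω) = w₀ and length ω = 24. -/
/-- The Coxeter matrix of type F₄. -/
def F4Matrix : CoxeterMatrix (Fin 4) where
  M := !![1, 3, 2, 2;
          3, 1, 4, 2;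
          2, 4, 1, 3;
          2, 2, 3, 1]
  off_diagonal := by
    intro i i' h
    fin_cases i <;> fin_cases i' <;> simp at h ⊢

/-- Vectors in the weight lattice of F₄, in coordinates with respect to the fundamental weights. -/
abbrev F4Weight : Type := ℤ × ℤ × ℤ × ℤ

namespace F4Weight

/-- The pairing of a weight with the `i`-th simple coroot. -/
def coord : Fin 4 → F4Weight → ℤ
  | 0, v => v.1
  | 1, v => v.2.1
  | 2, v => v.2.2.1
  | 3, v => v.2.2.2

/-- The `i`-th simple reflection on weights. -/
def refl : Fin 4 → F4Weight → F4Weight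
  | 0, (a, b, c, d) => (-a, a + b, c, d)
  | 1, (a, b, c, d) => (a + b, -b, c + 2 * b, d)
  | 2, (a, b, c, d) => (a, b + c, -c, c + d)
  | 3, (a, b, c, d) => (a, b, c + d, -d)

/-- The `i`-th simple reflection on coroots, in coordinates with respect to the simple coroots. -/
def corefl : Fin 4 → F4Weight → F4Weight
  | 0, (a, b, c, d) => (b - a, b, c, d)
  | 1, (a, b, c, d) => (a, a - b + 2 * c, c, d)
  | 2, (a, b, c, d) => (a, b, b - c + d, d)
  | 3, (a, b, c, d) => (a, b, c, c - d)

/-- The pairing of a coroot (in simple coroot coordinates) with a weight. -/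
def pairing (r v : F4Weight) : ℤ :=
  r.1 * v.1 + r.2.1 * v.2.1 + r.2.2.1 * v.2.2.1 + r.2.2.2 * v.2.2.2

theorem pairing_refl (i : Fin 4) (r v : F4Weight) :
    pairing r (refl i v) = pairing (corefl i r) v := by
  obtain ⟨a, b, c, d⟩ := r
  obtain ⟨x, y, z, t⟩ := v
  fin_cases i <;> simp [refl, corefl, pairing] <;> ring

/-- The simple coroots. -/
def simpleCoroot : Fin 4 → F4Weight
  | 0 => (1, 0, 0, 0)
  | 1 => (0, 1, 0, 0)
  | 2 => (0, 0, 1, 0)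
  | 3 => (0, 0, 0, 1)

theorem pairing_simpleCoroot (i : Fin 4) (v : F4Weight) :
    pairing (simpleCoroot i) v = coord i v := by
  fin_cases i <;> simp [pairing, simpleCoroot, coord]

/-- The positive coroots. -/
def posCoroots : List F4Weight :=
  [(0, 0, 0, 1), (0, 0, 1, 0), (0, 1, 0, 0), (1, 0, 0, 0), (0, 0, 1, 1), (0, 1, 1, 0),
    (1, 1, 0, 0), (0, 1, 1, 1), (0, 2, 1, 0), (1, 1, 1, 0), (0, 2, 1, 1), (1, 1, 1, 1),
    (1, 2, 1, 0), (0, 2, 2, 1), (1, 2, 1, 1), (2, 2, 1, 0), (1, 2, 2, 1), (2, 2, 1, 1),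
    (1, 3, 2, 1), (2, 2, 2, 1), (2, 3, 2, 1), (2, 4, 2, 1), (2, 4, 3, 1), (2, 4, 3, 2)]

/-- The number of positive coroots that are positive on `v`. -/
def height (v : F4Weight) : ℕ := posCoroots.countP fun r => 0 < pairing r v

theorem posCoroots_perm (i : Fin 4) :
    posCoroots.Perm (simpleCoroot i :: posCoroots.erase (simpleCoroot i)) := by
  revert i; decide +kernel

theorem map_corefl_posCoroots_perm (i : Fin 4) :
    (posCoroots.map (corefl i)).Perm
      (corefl i (simpleCoroot i) :: posCoroots.erase (simpleCoroot i)) := by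
  revert i; decide +kernel

theorem height_refl_add (i : Fin 4) (v : F4Weight) :
    height (refl i v) + (if 0 < coord i v then 1 else 0) =
      height v + (if coord i v < 0 then 1 else 0) := by
  have h₁ : height (refl i v) =
      (posCoroots.map (corefl i)).countP fun r => 0 < pairing r v := by
    simp [height, List.countP_map, Function.comp_def, pairing_refl]
  have h₂ : pairing (corefl i (simpleCoroot i)) v = -coord i v := by
    fin_cases i <;> simp [pairing, simpleCoroot, coord, corefl]
  rw [h₁, (map_corefl_posCoroots_perm i).countP_eq, height, (posCoroots_perm i).countP_eq]
  simp only [List.countP_cons, h₂, pairing_simpleCoroot, decide_eq_true_eq, Left.neg_pos_iff]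
  omega

theorem height_refl_of_pos {i : Fin 4} {v : F4Weight} (h : 0 < coord i v) :
    height (refl i v) + 1 = height v := by
  have := height_refl_add i v
  rw [if_pos h, if_neg h.not_gt] at this
  exact this

theorem height_le_height_refl {i : Fin 4} {v : F4Weight} (h : ¬0 < coord i v) :
    height v ≤ height (refl i v) := by
  have := height_refl_add i v
  rw [if_neg h] at this
  omega

theorem exists_coord_pos_of_height_ne_zero {v : F4Weight} (h : height v ≠ 0) :
    ∃ i, 0 < coord i v := by
  contrapose! h
  have h₀ := h 0
  have h₁ := h 1
  have h₂ := h 2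
  have h₃ := h 3
  simp only [coord] at h₀ h₁ h₂ h₃
  have nonneg : ∀ r ∈ posCoroots, 0 ≤ r.1 ∧ 0 ≤ r.2.1 ∧ 0 ≤ r.2.2.1 ∧ 0 ≤ r.2.2.2 := by
    decide +kernel
  refine List.countP_eq_zero.2 fun r hr => ?_
  obtain ⟨k₀, k₁, k₂, k₃⟩ := nonneg r hr
  rw [decide_eq_true_eq, not_lt, pairing]
  linarith [mul_nonpos_of_nonneg_of_nonpos k₀ h₀, mul_nonpos_of_nonneg_of_nonpos k₁ h₁,
    mul_nonpos_of_nonneg_of_nonpos k₂ h₂, mul_nonpos_of_nonneg_of_nonpos k₃ h₃]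

/-- Apply the simple reflections of a word to a weight, reading from left to right. -/
def walk (v : F4Weight) (ω : List (Fin 4)) : F4Weight := ω.foldl (fun u i => refl i u) v

/-- Each successive simple reflection of the word is applied at a positive coordinate. -/
def IsDescending : F4Weight → List (Fin 4) → Prop
  | _, [] => True
  | v, i :: ω => 0 < coord i v ∧ IsDescending (refl i v) ω

theorem isDescending_append {v : F4Weight} {ω ω' : List (Fin 4)} :
    IsDescending v (ω ++ ω') ↔ IsDescending v ω ∧ IsDescending (walk v ω) ω' := by
  induction ω generalizing v with
  | nil => simp [IsDescending, walk]
  | cons i ω ih => simp [IsDescending, walk, ih, and_assoc]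

theorem height_le_height_walk_add (v : F4Weight) (ω : List (Fin 4)) :
    height v ≤ height (walk v ω) + ω.length := by
  induction ω generalizing v with
  | nil => simp [walk]
  | cons i ω ih =>
    have h₁ := ih (refl i v)
    have h₂ := height_refl_add i v
    simp only [walk, List.foldl_cons, List.length_cons] at h₁ ⊢
    split_ifs at h₂ <;> omega

theorem isDescending_iff_height (v : F4Weight) (ω : List (Fin 4)) :
    IsDescending v ω ↔ height v = height (walk v ω) + ω.length := by
  induction ω generalizing v with
  | nil => simp [IsDescending, walk]
  | cons i ω ih =>
    have hle := height_le_height_walk_add (refl i v) ω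
    rw [IsDescending, ih]
    simp only [walk, List.foldl_cons, List.length_cons] at hle ⊢
    by_cases h : 0 < coord i v
    · have := height_refl_of_pos h
      simp only [h, true_and]
      omega
    · have := height_le_height_refl h
      simp only [h, false_and, false_iff]
      omega

theorem exists_isDescending_length_eq_height (v : F4Weight) :
    ∃ ω, IsDescending v ω ∧ ω.length = height v := by
  induction hn : height v generalizing v with
  | zero => exact ⟨[], trivial, rfl⟩
  | succ n ih =>
    obtain ⟨i, hi⟩ := exists_coord_pos_of_height_ne_zero (v := v) (by omega)
    have := height_refl_of_pos hi
    obtain ⟨ω, h, hl⟩ := ih (refl i v) (by omega)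
    exact ⟨i :: ω, ⟨hi, h⟩, by simp [hl]⟩

theorem refl_involutive (i : Fin 4) : Function.Involutive (refl i) := by
  rintro ⟨a, b, c, d⟩
  fin_cases i <;> simp only [refl] <;> ext <;> dsimp only <;> ring

/-- The `i`-th simple reflection as a permutation of the weights. -/
def reflPerm (i : Fin 4) : Equiv.Perm F4Weight := (refl_involutive i).toPerm

theorem isLiftable_reflPerm : F4Matrix.IsLiftable reflPerm := by
  intro i j
  ext1 ⟨a, b, c, d⟩
  fin_cases i <;> fin_cases j <;>
    simp only [F4Matrix, Matrix.of_apply, Matrix.cons_val', Matrix.cons_val, Fin.reduceFinMk,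
      Fin.zero_eta, Fin.mk_one, pow_succ, pow_zero, one_mul, Equiv.Perm.mul_apply, reflPerm,
      Function.Involutive.coe_toPerm, refl, Equiv.Perm.one_apply] <;>
    ext <;> dsimp only <;> ring

theorem walk_eq_lift (v : F4Weight) (ω : List (Fin 4)) :
    walk v ω =
      F4Matrix.toCoxeterSystem.lift ⟨reflPerm, isLiftable_reflPerm⟩
        (F4Matrix.toCoxeterSystem.wordProd ω)⁻¹ v := by
  induction ω generalizing v with
  | nil => simp [walk]
  | cons i ω ih =>
    rw [walk, List.foldl_cons, ← walk, ih, CoxeterSystem.wordProd_cons, mul_inv_rev, map_mul,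
      CoxeterSystem.inv_simple, CoxeterSystem.lift_apply_simple]
    rfl

theorem exists_braid {v : F4Weight} {i j : Fin 4} (hij : i ≠ j)
    (hi : 0 < coord i v) (hj : 0 < coord j v) :
    ∃ ω ω', IsDescending v (i :: ω) ∧ IsDescending v (j :: ω') ∧
      walk v (i :: ω) = walk v (j :: ω') ∧
      F4Matrix.toCoxeterSystem.wordProd (i :: ω) =
        F4Matrix.toCoxeterSystem.wordProd (j :: ω') := by
  wlog hlt : i < j generalizing i j
  · obtain ⟨ω, ω', h₁, h₂, h₃, h₄⟩ := this hij.symm hj hi (by omega)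
    exact ⟨ω', ω, h₂, h₁, h₃.symm, h₄.symm⟩
  have key : ∀ ω ω', (IsDescending v (i :: ω) ∧ IsDescending v (j :: ω')) →
      F4Matrix.toCoxeterSystem.wordProd (i :: ω) =
        F4Matrix.toCoxeterSystem.wordProd (j :: ω') →
      ∃ ω ω', IsDescending v (i :: ω) ∧ IsDescending v (j :: ω') ∧
        walk v (i :: ω) = walk v (j :: ω') ∧
        F4Matrix.toCoxeterSystem.wordProd (i :: ω) =
          F4Matrix.toCoxeterSystem.wordProd (j :: ω') := fun ω ω' h h' =>
    ⟨ω, ω', h.1, h.2, by rw [walk_eq_lift, walk_eq_lift, h'], h'⟩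
  have braid₂ (h : F4Matrix.M i j = 2) : F4Matrix.toCoxeterSystem.wordProd [i, j] =
      F4Matrix.toCoxeterSystem.wordProd [j, i] := by
    have := F4Matrix.toCoxeterSystem.wordProd_braidWord_eq i j
    rw [CoxeterSystem.braidWord, CoxeterSystem.braidWord, F4Matrix.symmetric j i, h] at this
    exact this
  have braid₃ (h : F4Matrix.M i j = 3) : F4Matrix.toCoxeterSystem.wordProd [i, j, i] =
      F4Matrix.toCoxeterSystem.wordProd [j, i, j] := by
    have := F4Matrix.toCoxeterSystem.wordProd_braidWord_eq i j
    rw [CoxeterSystem.braidWord, CoxeterSystem.braidWord, F4Matrix.symmetric j i, h] at this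
    exact this.symm
  have braid₄ (h : F4Matrix.M i j = 4) : F4Matrix.toCoxeterSystem.wordProd [i, j, i, j] =
      F4Matrix.toCoxeterSystem.wordProd [j, i, j, i] := by
    have := F4Matrix.toCoxeterSystem.wordProd_braidWord_eq i j
    rw [CoxeterSystem.braidWord, CoxeterSystem.braidWord, F4Matrix.symmetric j i, h] at this
    exact this
  obtain ⟨a, b, c, d⟩ := v
  fin_cases i <;> fin_cases j <;> simp [coord] at hi hj hij hlt
  · exact key [1, 0] [0, 1] (by simp [IsDescending, coord, refl]; omega) (braid₃ rfl)
  · exact key [2] [0] (by simp [IsDescending, coord, refl]; omega) (braid₂ rfl)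
  · exact key [3] [0] (by simp [IsDescending, coord, refl]; omega) (braid₂ rfl)
  · exact key [2, 1, 2] [1, 2, 1] (by simp [IsDescending, coord, refl]; omega) (braid₄ rfl)
  · exact key [3] [1] (by simp [IsDescending, coord, refl]; omega) (braid₂ rfl)
  · exact key [3, 2] [2, 3] (by simp [IsDescending, coord, refl]; omega) (braid₃ rfl)

/-- All maximal descending words from a given weight represent the same group element. -/
theorem wordProd_eq_of_isDescending {v : F4Weight} {ω ω' : List (Fin 4)}
    (h : IsDescending v ω) (hl : ω.length = height v)
    (h' : IsDescending v ω') (hl' : ω'.length = height v) :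
    F4Matrix.toCoxeterSystem.wordProd ω = F4Matrix.toCoxeterSystem.wordProd ω' := by
  induction hn : height v generalizing v ω ω' with
  | zero =>
    rw [hn, List.length_eq_zero_iff] at hl hl'
    rw [hl, hl']
  | succ n ih =>
    obtain ⟨i, t, rfl⟩ := List.exists_cons_of_length_eq_add_one (hl.trans hn)
    obtain ⟨j, t', rfl⟩ := List.exists_cons_of_length_eq_add_one (hl'.trans hn)
    have tail_eq {k : Fin 4} {s s' : List (Fin 4)} (hs : IsDescending v (k :: s))
        (hsl : (k :: s).length = height v) (hs' : IsDescending v (k :: s'))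
        (hsl' : (k :: s').length = height v) :
        F4Matrix.toCoxeterSystem.wordProd (k :: s) =
          F4Matrix.toCoxeterSystem.wordProd (k :: s') := by
      have := height_refl_of_pos hs.1
      rw [List.length_cons] at hsl hsl'
      rw [CoxeterSystem.wordProd_cons, CoxeterSystem.wordProd_cons,
        ih hs.2 (by omega) hs'.2 (by omega) (by omega)]
    by_cases hij : i = j
    · subst hij
      exact tail_eq h hl h' hl'
    obtain ⟨ω, ω', hd, hd', hw, hp⟩ := exists_braid hij h.1 h'.1
    obtain ⟨u, hu, hul⟩ := exists_isDescending_length_eq_height (walk v (i :: ω))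
    have e := (isDescending_iff_height _ _).1 hd
    have e' := (isDescending_iff_height _ _).1 hd'
    rw [← hw] at e'
    have hdu : IsDescending v (i :: (ω ++ u)) := isDescending_append.2 ⟨hd, hu⟩
    have hdu' : IsDescending v (j :: (ω' ++ u)) := isDescending_append.2 ⟨hd', hw ▸ hu⟩
    simp only [List.length_cons] at e e'
    rw [tail_eq h hl hdu (by simp; omega), tail_eq h' hl' hdu' (by simp; omega),
      ← List.cons_append, ← List.cons_append, CoxeterSystem.wordProd_append,
      CoxeterSystem.wordProd_append, hp]

/-- The number of descending words of length `n` from `v`. -/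
def numDescending : ℕ → F4Weight → ℕ
  | 0, _ => 1
  | n + 1, v => ∑ i, if 0 < coord i v then numDescending n (refl i v) else 0

/-- The descending words of length `n` from `v`. -/
def descendingWords : ℕ → F4Weight → Finset (List (Fin 4))
  | 0, _ => {[]}
  | n + 1, v => (Finset.univ.filter fun i => 0 < coord i v).biUnion fun i =>
      (descendingWords n (refl i v)).map ⟨List.cons i, List.cons_injective⟩

theorem mem_descendingWords {n : ℕ} {v : F4Weight} {ω : List (Fin 4)} :
    ω ∈ descendingWords n v ↔ IsDescending v ω ∧ ω.length = n := by
  induction n generalizing v ω with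
  | zero => cases ω <;> simp [descendingWords, IsDescending]
  | succ n ih => cases ω <;> simp [descendingWords, IsDescending, ih, and_assoc]

theorem card_descendingWords (n : ℕ) (v : F4Weight) :
    (descendingWords n v).card = numDescending n v := by
  induction n generalizing v with
  | zero => rfl
  | succ n ih =>
    rw [descendingWords, Finset.card_biUnion]
    · simp [numDescending, ih, Finset.sum_filter]
    · intro i _ j _ hij
      simp only [Finset.disjoint_left, Finset.mem_map]
      rintro _ ⟨s, _, rfl⟩ ⟨t, _, h⟩
      exact hij (List.cons.inj h).1.symm

/-- Formal sums of weights with natural number multiplicities, stored as binary search trees.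
Each node consists of a left subtree, a numerical key for comparison, a weight, its multiplicity
and a right subtree. -/
inductive WeightSum
  | zero : WeightSum
  | node : WeightSum → ℕ → F4Weight → ℕ → WeightSum → WeightSum

namespace WeightSum

/-- Evaluate a formal sum of weights along a function on weights. -/
def eval (f : F4Weight → ℕ) : WeightSum → ℕ
  | zero => 0
  | node l _ v c r => eval f l + c * f v + eval f r

/-- The total multiplicity of a formal sum of weights. -/
def total : WeightSum → ℕ
  | zero => 0
  | node l _ _ c r => total l + c + total r

/-- Add `c • v` to a formal sum of weights, where `q` is the key of `v`. -/
def addTerm (q : ℕ) (v : F4Weight) (c : ℕ) : WeightSum → WeightSum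
  | zero => node zero q v c zero
  | node l p u k r =>
    bif Nat.ble q p then
      bif Nat.beq q p && decide (v = u) then node l p u (c + k) r
      else node (addTerm q v c l) p u k r
    else node l p u k (addTerm q v c r)

/-- The key used to compare weights. The modular multiplication keeps the search trees balanced. -/
def key (v : F4Weight) : ℕ :=
  (v.1 + 128 * v.2.1 + 16384 * v.2.2.1 + 2097152 * v.2.2.2 + 34359738368).toNat *
    7368787 % 15485863

/-- Add the image of `c • v` under the `i`-th simple reflection, if it descends. -/
def addRefl (i : Fin 4) (v : F4Weight) (c : ℕ) (t : WeightSum) : WeightSum :=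
  if 0 < coord i v then addTerm (key (refl i v)) (refl i v) c t else t

/-- Add to the second formal sum all descending simple reflections of the terms of the first. -/
def descendInto : WeightSum → WeightSum → WeightSum
  | zero, t => t
  | node l _ v c r, t =>
    descendInto l (descendInto r
      (addRefl 0 v c (addRefl 1 v c (addRefl 2 v c (addRefl 3 v c t)))))

/-- Replace each weight of a formal sum by the sum of its descending simple reflections. -/
def descend (t : WeightSum) : WeightSum := descendInto t zero

theorem eval_addTerm (f : F4Weight → ℕ) (q : ℕ) (v : F4Weight) (c : ℕ) (t : WeightSum) :
    eval f (addTerm q v c t) = c * f v + eval f t := by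
  induction t with
  | zero => simp [eval, addTerm]
  | node l p u k r ihl ihr =>
    simp only [addTerm, cond_eq_ite]
    split_ifs with h₁ h₂
    · obtain rfl : v = u := by simp_all
      simp only [eval]
      ring
    · simp only [eval, ihl]
      ring
    · simp only [eval, ihr]
      ring

theorem eval_addRefl (f : F4Weight → ℕ) (i : Fin 4) (v : F4Weight) (c : ℕ) (t : WeightSum) :
    eval f (addRefl i v c t) =
      c * (if 0 < coord i v then f (refl i v) else 0) + eval f t := by
  rw [addRefl]
  split_ifs
  · exact eval_addTerm f _ _ c t
  · simp

theorem eval_descendInto (n : ℕ) (s t : WeightSum) :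
    eval (numDescending n) (descendInto s t) =
      eval (numDescending (n + 1)) s + eval (numDescending n) t := by
  induction s generalizing t with
  | zero => simp [eval, descendInto]
  | node l p v c r ihl ihr =>
    rw [descendInto, ihl, ihr, eval_addRefl, eval_addRefl, eval_addRefl, eval_addRefl]
    simp only [eval, numDescending, Fin.sum_univ_four]
    ring

theorem eval_numDescending_zero (t : WeightSum) : eval (numDescending 0) t = total t := by
  induction t with
  | zero => rfl
  | node l p v c r ihl ihr => rw [eval, total, ihl, ihr, numDescending, mul_one]

theorem eval_numDescending (n : ℕ) (t : WeightSum) :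
    eval (numDescending n) t = total (descend^[n] t) := by
  induction n generalizing t with
  | zero => exact eval_numDescending_zero t
  | succ n ih =>
    rw [Function.iterate_succ_apply, ← ih, descend, eval_descendInto]
    rfl

end WeightSum

theorem numDescending_eq_total (n : ℕ) (v : F4Weight) :
    numDescending n v = (WeightSum.descend^[n] (.node .zero 0 v 1 .zero)).total := by
  simp [← WeightSum.eval_numDescending, WeightSum.eval]

theorem numDescending_rho : numDescending 24 (1, 1, 1, 1) = 2144892 := by
  rw [numDescending_eq_total]
  decide +kernel

end F4Weight

/-- In the Coxeter group of type F₄, the longest element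
`w₀ = π(4 3 4 2 3 4 2 3 2 1 2 3 4 2 3 1 2 3 4 1 2 3 2 1)` (generators 0-based here, of
length 24) has exactly 2144892 reduced words, i.e. lists `ω` of generator indices with
`π ω = w₀` and `ω.length = 24`. -/
theorem F4_longest_word_reduced_words_count :
    Nat.card {ω : List (Fin 4) //
      F4Matrix.toCoxeterSystem.wordProd ω =
        F4Matrix.toCoxeterSystem.wordProd
          [3, 2, 3, 1, 2, 3, 1, 2, 1, 0, 1, 2, 3, 1, 2, 0, 1, 2, 3, 0, 1, 2, 1, 0] ∧
      ω.length = 24} = 2144892 := by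
  open F4Weight in
  set w₀ : List (Fin 4) :=
    [3, 2, 3, 1, 2, 3, 1, 2, 1, 0, 1, 2, 3, 1, 2, 0, 1, 2, 3, 0, 1, 2, 1, 0]
  have hρ : height (1, 1, 1, 1) = 24 := by decide +kernel
  have hlow : height (walk (1, 1, 1, 1) w₀) = 0 := by decide +kernel
  have hdesc : IsDescending (1, 1, 1, 1) w₀ := by
    rw [isDescending_iff_height, hρ, hlow]
    rfl
  have hmem (ω : List (Fin 4)) :
      (F4Matrix.toCoxeterSystem.wordProd ω = F4Matrix.toCoxeterSystem.wordProd w₀ ∧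
        ω.length = 24) ↔ ω ∈ descendingWords 24 (1, 1, 1, 1) := by
    rw [mem_descendingWords]
    refine and_congr_left fun hl => ⟨fun h => ?_, fun h => ?_⟩
    · rw [isDescending_iff_height, walk_eq_lift, h, ← walk_eq_lift, hlow, hρ, hl]
    · exact wordProd_eq_of_isDescending h (hl.trans hρ.symm) hdesc hρ.symm
  rw [Nat.card_congr (Equiv.subtypeEquivRight hmem), Nat.card_eq_fintype_card,
    Fintype.card_coe, card_descendingWords, numDescending_rho]
end
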